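/- arXiv:1709.05970 — 2 statements merged into one kernel-verified Lean document; each statement's English description precedes it below -/
import Mathlib

section
/- Let p_1, …, p_l be distinct primes and let q = p_1·p_2···p_l. Let F be a finite field whose characteristic is among p_1, …, p_l (equivalently, the image of q in F is zero), and let E be a finite-dimensional vector space over F. Then for all subspaces A, B_1, …, B_q, X, Z, Y_1, …, Y_q of E the following inequality holds: 2H(A) + (q+1)H(B_1) + Σ_{i=2}^{q} 2H(B_i) ≤ (2q−1)H(X) + Σ_{i=1}^{q} H(Y_i) + H(Z) + 3q·H(X | A, B_1, …, B_q) + (q+2)H(Y_1 | A, B_2, …, B_q) + Σ_{i=2}^{q} 3H(Y_i | A, B_1, …, B_{i−1}, B_{i+1}, …, B_q) + 2H(Z | B_1, …, B_q) + H(A | Y_1, …, Y_q, Z) + H(A | X, Z) + (q+1)H(B_1 | X, Y_1) + Σ_{i=2}^{q} 2H(B_i | X, Y_i) + (3q+1)(H(A) + Σ_{i=1}^{q} H(B_i) − H(A, B_1, …, B_q)). -/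
open Finset

/-- `H(S)`: the dimension of a subspace `S`, as an integer. -/
noncomputable def sdim (F : Type*) {E : Type*} [Field F] [AddCommGroup E] [Module F E]
    (S : Submodule F E) : ℤ :=
  Module.finrank F ↥S

/-- `H(S | T)`: the conditional term `dim (S + T) - dim T`, as an integer. -/
noncomputable def scdim (F : Type*) {E : Type*} [Field F] [AddCommGroup E] [Module F E]
    (S T : Submodule F E) : ℤ :=
  Module.finrank F ↥(S ⊔ T) - Module.finrank F ↥T

/-- The index `1` (i.e. the first of `1, …, q`, realized as `0 : Fin q`), available since `q`,
being a product of primes, is positive. -/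
def idx1 {l : ℕ} {p : Fin l → ℕ} (hp : ∀ i, (p i).Prime) {q : ℕ}
    (hq : q = ∏ i, p i) : Fin q :=
  ⟨0, lt_of_lt_of_eq (Finset.prod_pos fun i _ => (hp i).pos) hq.symm⟩


section Helpers

set_option linter.unusedSectionVars false

variable {F E : Type*} [Field F] [AddCommGroup E] [Module F E] [FiniteDimensional F E]

lemma sdim_mono {S T : Submodule F E} (h : S ≤ T) : sdim F S ≤ sdim F T := by
  unfold sdim
  exact_mod_cast Submodule.finrank_mono h

lemma sdim_nonneg (S : Submodule F E) : 0 ≤ sdim F S := by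
  unfold sdim
  positivity

lemma sdim_modular (S T : Submodule F E) :
    sdim F (S ⊔ T) + sdim F (S ⊓ T) = sdim F S + sdim F T := by
  unfold sdim
  exact_mod_cast Submodule.finrank_sup_add_finrank_inf_eq S T

lemma scdim_eq (S T : Submodule F E) : scdim F S T = sdim F (S ⊔ T) - sdim F T := rfl

lemma scdim_eq' (S T : Submodule F E) : scdim F S T = sdim F S - sdim F (S ⊓ T) := by
  have := sdim_modular S T
  rw [scdim_eq]; linarith

lemma sdim_map_ker (f : E →ₗ[F] E) (S : Submodule F E) :
    sdim F (S.map f) + sdim F (S ⊓ LinearMap.ker f) = sdim F S := by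
  have h := LinearMap.finrank_range_add_finrank_ker (f.domRestrict S)
  rw [LinearMap.range_domRestrict] at h
  have h2 : Module.finrank F (LinearMap.ker (f.domRestrict S))
      = Module.finrank F ↥(S ⊓ LinearMap.ker f) := by
    rw [← Submodule.map_comap_subtype, Submodule.finrank_map_subtype_eq]
    congr
  rw [h2] at h
  unfold sdim
  exact_mod_cast h

lemma sdim_step (f : E →ₗ[F] E) {R S D : Submodule F E} (h1 : R ≤ S) (h2 : R ≤ LinearMap.ker f)
    (h3 : D ≤ S.map f) : sdim F R + sdim F D ≤ sdim F S := by
  have := sdim_map_ker f S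
  have := sdim_mono h3
  have := sdim_mono (le_inf h1 h2)
  linarith

lemma sdim_sup_le (S T : Submodule F E) : sdim F (S ⊔ T) ≤ sdim F S + sdim F T := by
  have := sdim_modular S T
  have := sdim_nonneg (S ⊓ T)
  linarith

lemma sdim_iSup_le {ι : Type*} [DecidableEq ι] (B : ι → Submodule F E) (s : Finset ι) :
    sdim F (⨆ i ∈ s, B i) ≤ ∑ i ∈ s, sdim F (B i) := by
  induction s using Finset.induction_on with
  | empty => simp [sdim]
  | insert a s ha ih =>
    rw [Finset.iSup_insert, Finset.sum_insert ha]
    have := sdim_sup_le (B a) (⨆ i ∈ s, B i)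
    linarith

lemma exists_indep {κ : Type*} [Fintype κ] [DecidableEq κ] (n : ℕ) :
    ∀ S : κ → Submodule F E, ∑ i, Module.finrank F (S i) = n →
    ∃ T : κ → Submodule F E, (∀ i, T i ≤ S i) ∧ iSup T = iSup S ∧ iSupIndep T := by
  induction n using Nat.strong_induction_on with
  | _ n ih =>
  intro S hS
  by_cases hi : iSupIndep S
  · exact ⟨S, fun _ => le_rfl, rfl, hi⟩
  · unfold iSupIndep at hi
    push Not at hi
    obtain ⟨i, hi⟩ := hi
    set D := S i ⊓ ⨆ j, ⨆ (_ : j ≠ i), S j with hD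
    have hD0 : D ≠ ⊥ := fun h => hi (disjoint_iff.2 h)
    obtain ⟨Q, hQ⟩ := Submodule.exists_isCompl D
    have hDS : D ≤ S i := inf_le_left
    have hmod : D ⊔ (Q ⊓ S i) = S i := by
      rw [← sup_inf_assoc_of_le Q hDS, hQ.sup_eq_top, top_inf_eq]
    have hlt : Q ⊓ S i < S i := by
      refine lt_of_le_of_ne inf_le_right fun h => hD0 ?_
      have : D ≤ Q := hDS.trans (inf_eq_right.1 h)
      have h2 := hQ.inf_eq_bot
      rwa [inf_eq_left.2 this] at h2
    have hle : ∀ j, Function.update S i (Q ⊓ S i) j ≤ S j := by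
      intro j
      by_cases hj : j = i
      · subst hj; simp
      · simp [hj]
    obtain ⟨T, h1, h2, h3⟩ := ih (∑ j, Module.finrank F (Function.update S i (Q ⊓ S i) j))
      (by
        rw [← hS]
        refine Finset.sum_lt_sum (fun j _ => Submodule.finrank_mono (hle j)) ⟨i, mem_univ _, ?_⟩
        refine Submodule.finrank_lt_finrank_of_lt ?_
        rw [Function.update_self]
        exact hlt) _ rfl
    refine ⟨T, fun j => (h1 j).trans (hle j), h2.trans (le_antisymm (iSup_mono hle) ?_), h3⟩
    have hne : ∀ j, j ≠ i → S j ≤ iSup (Function.update S i (Q ⊓ S i)) := by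
      intro j hj
      have := le_iSup (Function.update S i (Q ⊓ S i)) j
      simpa [hj] using this
    refine iSup_le fun j => ?_
    by_cases hj : j = i
    · subst hj
      refine hmod.symm.le.trans ?_
      refine sup_le (inf_le_right.trans (iSup₂_le hne)) ?_
      have := le_iSup (Function.update S j (Q ⊓ S j)) j
      simpa using this
    · exact hne j hj

lemma exists_proj {κ : Type*} [Fintype κ] [DecidableEq κ] (T : κ → Submodule F E)
    (hT : iSupIndep T) : ∃ π : κ → (E →ₗ[F] E), (∀ i v, π i v ∈ T i) ∧
      (∀ i, ∀ v ∈ T i, π i v = v) ∧ (∀ i j, i ≠ j → ∀ v ∈ T j, π i v = 0) ∧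
      (∀ v ∈ iSup T, v = ∑ i, π i v) := by
  have hinj := hT.dfinsupp_lsum_injective
  obtain ⟨g, hg⟩ := LinearMap.exists_leftInverse_of_injective _ (LinearMap.ker_eq_bot.2 hinj)
  have hg' : ∀ j (v : T j), g v = DFinsupp.single j v := by
    intro j v
    have := LinearMap.congr_fun hg (DFinsupp.single j v)
    simpa using this
  have hself : ∀ i, ∀ v ∈ T i, ((g v i : T i) : E) = v := by
    intro i v hv
    rw [hg' i ⟨v, hv⟩]; simp
  have hother : ∀ i j, i ≠ j → ∀ v ∈ T j, ((g v i : T i) : E) = 0 := by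
    intro i j hij v hv
    rw [hg' j ⟨v, hv⟩, DFinsupp.single_eq_of_ne hij]; simp
  refine ⟨fun i => (T i).subtype ∘ₗ
    (DFinsupp.lapply i : (Π₀ i, T i) →ₗ[F] T i) ∘ₗ g, fun i v => ?_, hself, hother, ?_⟩
  · simp
  · intro v hv
    induction hv using Submodule.iSup_induction' with
    | mem i v hv =>
      rw [Finset.sum_eq_single i]
      · exact (hself i v hv).symm
      · intro j _ hj
        exact hother j i hj v hv
      · simp
    | zero => simp
    | add x y _ _ hx hy =>
      simp only [map_add, Finset.sum_add_distrib]
      rw [← hx, ← hy]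

end Helpers

section Base

variable {F E : Type*} [Field F] [AddCommGroup E] [Module F E] [FiniteDimensional F E]

lemma sdim_iInf_ge {ι : Type*} [DecidableEq ι] (X : Submodule F E) (V : ι → Submodule F E)
    (hV : ∀ i, V i ≤ X) (s : Finset ι) :
    sdim F X + ∑ i ∈ s, sdim F (V i) ≤ sdim F (X ⊓ ⨅ i ∈ s, V i) + (s.card : ℤ) * sdim F X := by
  induction s using Finset.induction_on with
  | empty => simp
  | insert a s ha ih =>
    rw [Finset.iInf_insert, Finset.sum_insert ha, Finset.card_insert_of_notMem ha]
    have h1 := sdim_modular (V a) (X ⊓ ⨅ i ∈ s, V i)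
    have h2 : sdim F (V a ⊔ (X ⊓ ⨅ i ∈ s, V i)) ≤ sdim F X :=
      sdim_mono (sup_le (hV a) inf_le_left)
    rw [inf_left_comm] at h1
    push_cast
    linarith

lemma sdim_sum_rel {ι : Type*} [Fintype ι] (Y : ι → Submodule F E) (Z R : Submodule F E)
    (f : ι → E →ₗ[F] E) (g : E →ₗ[F] E)
    (hf : ∀ i, ∀ x ∈ R, f i x ∈ Y i) (hg : ∀ x ∈ R, g x ∈ Z)
    (hsum : ∀ x ∈ R, ∑ i, f i x + g x = 0)
    (hinj : ∀ x ∈ R, (∀ i, f i x = 0) → g x = 0 → x = 0) :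
    sdim F ((⨆ i, Y i) ⊔ Z) + sdim F R ≤ ∑ i, sdim F (Y i) + sdim F Z := by
  classical
  let S : ((Π i, Y i) × Z) →ₗ[F] E :=
    LinearMap.coprod (∑ i, (Y i).subtype ∘ₗ LinearMap.proj i) Z.subtype
  have hS : ∀ w, S w = ∑ i, ((w.1 i : Y i) : E) + (w.2 : E) := by
    intro w
    simp [S]
  have hrn := LinearMap.finrank_range_add_finrank_ker S
  rw [Module.finrank_prod, Module.finrank_pi_fintype] at hrn
  have h1 : (⨆ i, Y i) ⊔ Z ≤ LinearMap.range S := by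
    refine sup_le (iSup_le fun i y hy => ?_) fun z hz => ?_
    · refine ⟨(Pi.single i ⟨y, hy⟩, 0), ?_⟩
      rw [hS, Finset.sum_eq_single i]
      · simp
      · intro j _ hj
        simp [hj]
      · simp
    · exact ⟨(0, ⟨z, hz⟩), by simp [hS]⟩
  let φ : R →ₗ[F] LinearMap.ker S := LinearMap.codRestrict _
    (LinearMap.prod (LinearMap.pi fun i => ((f i).restrict (hf i))) (g.restrict hg))
    (by
      intro x
      rw [LinearMap.mem_ker, hS]
      simpa using hsum x x.2)
  have hφ : Function.Injective φ := by
    rw [injective_iff_map_eq_zero]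
    intro x hx
    have h2 := congrArg Subtype.val hx
    have h3 := Prod.ext_iff.1 h2
    have ha : ∀ i, f i x = 0 := fun i => congrArg Subtype.val (congrFun h3.1 i)
    have hb : g x = 0 := congrArg Subtype.val h3.2
    exact Subtype.ext (hinj x x.2 ha hb)
  have h4 := LinearMap.finrank_le_finrank_of_injective hφ
  have h5 := Submodule.finrank_mono h1
  have h6 : Module.finrank F ↥((⨆ i, Y i) ⊔ Z) + Module.finrank F R
      ≤ ∑ i, Module.finrank F (Y i) + Module.finrank F Z := by omega
  unfold sdim
  exact_mod_cast h6

lemma base_case {ι : Type*} [Fintype ι] [DecidableEq ι] (i0 : ι)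
    (hcard : (Fintype.card ι : F) = 0)
    (A X Z : Submodule F E) (B Y : ι → Submodule F E)
    (P : E →ₗ[F] E) (π : ι → E →ₗ[F] E)
    (hPA : ∀ v, P v ∈ A) (hPa : ∀ v ∈ A, P v = v) (hPb : ∀ i, ∀ v ∈ B i, P v = 0)
    (hπB : ∀ i v, π i v ∈ B i) (hπa : ∀ i, ∀ v ∈ A, π i v = 0)
    (hπb : ∀ i, ∀ v ∈ B i, π i v = v) (hπne : ∀ i j, i ≠ j → ∀ v ∈ B j, π i v = 0)
    (hX : ∀ v ∈ X, v = P v + ∑ i, π i v)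
    (hY : ∀ i, ∀ v ∈ Y i, π i v = 0) (hZ : ∀ v ∈ Z, P v = 0) :
    2 * sdim F A + ((Fintype.card ι : ℤ) + 1) * sdim F (B i0)
        + ∑ i ∈ univ.erase i0, 2 * sdim F (B i)
      ≤ (2 * (Fintype.card ι : ℤ) - 1) * sdim F X + ∑ i, sdim F (Y i) + sdim F Z
        + scdim F A ((⨆ i, Y i) ⊔ Z)
        + scdim F A (X ⊔ Z)
        + ((Fintype.card ι : ℤ) + 1) * scdim F (B i0) (X ⊔ Y i0)
        + ∑ i ∈ univ.erase i0, 2 * scdim F (B i) (X ⊔ Y i) := by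
  set n : ℤ := (Fintype.card ι : ℤ) with hn
  have hn1 : 1 ≤ n := by
    have : 0 < Fintype.card ι := Fintype.card_pos_iff.2 ⟨i0⟩
    omega
  -- the pieces of X
  let V : ι → Submodule F E := fun i => X ⊓ (Y i).comap (LinearMap.id - π i)
  let V0 : Submodule F E := X ⊓ Z.comap (LinearMap.id - P)
  have hV : ∀ i x, x ∈ V i ↔ x ∈ X ∧ x - π i x ∈ Y i := fun i x => Iff.rfl
  have hV0 : ∀ x, x ∈ V0 ↔ x ∈ X ∧ x - P x ∈ Z := fun x => Iff.rfl
  have hVX : ∀ i, V i ≤ X := fun i => inf_le_left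
  have hV0X : V0 ≤ X := inf_le_left
  let V' : Submodule F E := X ⊓ ⨅ i ∈ (univ : Finset ι), V i
  have hV' : ∀ x, x ∈ V' → x ∈ X ∧ ∀ i, x - π i x ∈ Y i := by
    intro x hx
    refine ⟨hx.1, fun i => ?_⟩
    have h := hx.2
    simp only [SetLike.mem_coe, Submodule.mem_iInf] at h
    exact (h i (mem_univ _)).2
  -- key relation
  have hrel : ∀ x ∈ X, ∑ i, (x - π i x) + (x - P x) = 0 := by
    intro x hx
    have h := hX x hx
    rw [Finset.sum_sub_distrib, Finset.sum_const, Finset.card_univ,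
      ← Nat.cast_smul_eq_nsmul F, hcard, zero_smul]
    have h2 : x - P x = ∑ i, π i x := by
      rw [sub_eq_iff_eq_add']; exact h
    rw [h2]; simp
  -- relation bound
  have hYZ : sdim F ((⨆ i, Y i) ⊔ Z) + sdim F (V' ⊓ V0) ≤ ∑ i, sdim F (Y i) + sdim F Z := by
    refine sdim_sum_rel Y Z (V' ⊓ V0) (fun i => LinearMap.id - π i) (LinearMap.id - P)
      ?_ ?_ ?_ ?_
    · intro i x hx
      exact (hV' x hx.1).2 i
    · intro x hx
      exact hx.2.2
    · intro x hx
      exact hrel x hx.2.1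
    · intro x hx h1 h2
      have h3 : x - π i0 x = 0 := h1 i0
      have h4 : x - P x = 0 := h2
      rw [sub_eq_zero] at h3 h4
      rw [h3, h4, hπa i0 _ (hPA x)]
  -- A part
  have hA : sdim F (A ⊓ (X ⊔ Z)) ≤ sdim F V0 := by
    have h1 : A ⊓ (X ⊔ Z) ≤ V0.map P := by
      rintro a ⟨ha, hxz⟩
      obtain ⟨x, hx, z, hz, rfl⟩ := Submodule.mem_sup.1 hxz
      have h2 := hPa _ ha
      rw [map_add, hZ z hz, add_zero] at h2
      refine ⟨x, ⟨hx, ?_⟩, h2⟩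
      change x - P x ∈ Z
      rw [h2]
      simpa using hz
    have := sdim_mono h1
    have := sdim_map_ker P V0
    have := sdim_nonneg (V0 ⊓ LinearMap.ker P)
    linarith
  let k : ι → ℤ := fun i => sdim F (V i ⊓ LinearMap.ker (π i))
  have hk : ∀ i, 0 ≤ k i := fun i => sdim_nonneg _
  -- B part
  have hB : ∀ i, sdim F (B i ⊓ (X ⊔ Y i)) + k i ≤ sdim F (V i) := by
    intro i
    have h1 : B i ⊓ (X ⊔ Y i) ≤ (V i).map (π i) := by
      rintro a ⟨ha, hxz⟩
      obtain ⟨x, hx, z, hz, rfl⟩ := Submodule.mem_sup.1 hxz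
      have h2 := hπb i _ ha
      rw [map_add, hY i z hz, add_zero] at h2
      refine ⟨x, ⟨hx, ?_⟩, h2⟩
      change x - π i x ∈ Y i
      rw [h2]
      simpa using hz
    have := sdim_mono h1
    have := sdim_map_ker (π i) (V i)
    change _ + sdim F (V i ⊓ LinearMap.ker (π i)) ≤ _
    linarith
  -- W bound
  set W : Submodule F E := A ⊔ ((⨆ i, Y i) ⊔ Z) with hW
  have hAW : A ≤ W := le_sup_left
  have hYW : ∀ i, Y i ≤ W := fun i => (le_iSup Y i).trans (le_sup_left.trans le_sup_right)
  have hZW : Z ≤ W := le_sup_right.trans le_sup_right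
  let U : Submodule F E := ((V i0 ⊓ V0) ⊔ V').map (π i0)
  have hUker : ∀ f : E →ₗ[F] E, (∀ v ∈ B i0, f v = 0) → U ≤ LinearMap.ker f := by
    rintro f hf _ ⟨x, hx, rfl⟩
    exact hf _ (hπB i0 x)
  have hVW : (V i0 ⊓ V0) ⊔ V' ≤ W := by
    refine sup_le ?_ ?_
    · rintro x ⟨_, hx⟩
      have := W.add_mem (hZW hx.2) (hAW (hPA x))
      simpa using this
    · intro x hx
      obtain ⟨hxX, hx⟩ := hV' x hx
      have h1 : ∑ i, (x - π i x) ∈ W := Submodule.sum_mem _ fun i _ => hYW i (hx i)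
      have h2 : x - P x ∈ W := by
        rw [eq_neg_of_add_eq_zero_right (hrel x hxX)]
        exact W.neg_mem h1
      have := W.add_mem h2 (hAW (hPA x))
      simpa using this
  have hVi0 : (V i0 ⊓ V0) ⊔ V' ≤ V i0 := by
    refine sup_le inf_le_left ?_
    intro x hx
    exact ⟨(hV' x hx).1, (hV' x hx).2 i0⟩
  have hUW : U ≤ W := by
    rintro _ ⟨x, hx, rfl⟩
    have h1 := hVW hx
    have h2 := hYW i0 (hVi0 hx).2
    have := W.sub_mem h1 h2
    simpa using this
  let G : ι → Submodule F E := fun i => (V i0 ⊓ V i).map (π i - π i0)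
  let D : ι → Submodule F E := fun i => (V i0 ⊓ V i).map (π i)
  have hGW : ∀ i, G i ≤ W := by
    rintro i _ ⟨x, hx, rfl⟩
    have h1 := hYW i0 hx.1.2
    have h2 := hYW i hx.2.2
    have := W.sub_mem h1 h2
    simpa using this
  have hchain : ∀ s : Finset ι, s ⊆ univ.erase i0 →
      sdim F A + sdim F U + ∑ i ∈ s, sdim F (D i) ≤ sdim F (A ⊔ U ⊔ ⨆ i ∈ s, G i) := by
    intro s
    induction s using Finset.induction_on with
    | empty =>
      intro _
      have := sdim_step P (R := U) (S := A ⊔ U) (D := A) le_sup_right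
        (hUker P (hPb i0)) (fun a ha => ⟨a, Submodule.mem_sup_left ha, hPa a ha⟩)
      simp only [Finset.sum_empty, Finset.notMem_empty, iSup_false, iSup_bot, sup_bot_eq]
      linarith
    | insert j s hj ih =>
      intro hs
      have hs' : s ⊆ univ.erase i0 := (Finset.subset_insert j s).trans hs
      have hj0 : j ≠ i0 := (Finset.mem_erase.1 (hs (Finset.mem_insert_self j s))).1
      have ih := ih hs'
      rw [Finset.sum_insert hj, Finset.iSup_insert]
      have h := sdim_step (π j) (R := A ⊔ U ⊔ ⨆ i ∈ s, G i)
        (S := A ⊔ U ⊔ (G j ⊔ ⨆ i ∈ s, G i)) (D := D j)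
        (sup_le_sup_left le_sup_right _)
        (by
          refine sup_le (sup_le (fun v hv => hπa j v hv) (hUker _ (hπne j i0 hj0))) ?_
          refine iSup₂_le fun i hi => ?_
          rintro _ ⟨x, hx, rfl⟩
          have hji : j ≠ i := fun h => hj (h ▸ hi)
          simp [hπne j i hji _ (hπB i x), hπne j i0 hj0 _ (hπB i0 x)])
        (by
          rintro _ ⟨x, hx, rfl⟩
          refine ⟨(π j - π i0) x, ?_, ?_⟩
          · exact Submodule.mem_sup_right (Submodule.mem_sup_left ⟨x, hx, rfl⟩)
          · simp [hπb j _ (hπB j x), hπne j i0 hj0 _ (hπB i0 x)])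
      linarith
  have hWdim : sdim F A + sdim F U + ∑ i ∈ univ.erase i0, sdim F (D i) ≤ sdim F W :=
    (hchain _ subset_rfl).trans
      (sdim_mono (sup_le (sup_le hAW hUW) (iSup₂_le fun i _ => hGW i)))
  -- lower bounds
  have hU : sdim F ((V i0 ⊓ V0) ⊔ V') ≤ sdim F U + k i0 := by
    have h1 := sdim_map_ker (π i0) ((V i0 ⊓ V0) ⊔ V')
    have h2 := sdim_mono (inf_le_inf_right (LinearMap.ker (π i0)) hVi0)
    change _ ≤ sdim F U + sdim F _
    linarith
  have hD : ∀ i, sdim F (V i0) + sdim F (V i) - sdim F X ≤ sdim F (D i) + k i := by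
    intro i
    have h1 := sdim_map_ker (π i) (V i0 ⊓ V i)
    have h2 := sdim_mono (inf_le_inf_right (LinearMap.ker (π i))
      (inf_le_right : V i0 ⊓ V i ≤ V i))
    have h3 := sdim_modular (V i0) (V i)
    have h4 := sdim_mono (sup_le (hVX i0) (hVX i))
    change _ ≤ sdim F (D i) + sdim F _
    linarith
  have hU2 : sdim F (V i0 ⊓ V0) + sdim F V'
      ≤ sdim F ((V i0 ⊓ V0) ⊔ V') + sdim F (V' ⊓ V0) := by
    have h1 := sdim_modular (V i0 ⊓ V0) V'
    have h2 : (V i0 ⊓ V0) ⊓ V' ≤ V' ⊓ V0 := fun x hx => ⟨hx.2, hx.1.2⟩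
    have := sdim_mono h2
    linarith
  have hU3 : sdim F (V i0) + sdim F V0 - sdim F X ≤ sdim F (V i0 ⊓ V0) := by
    have h1 := sdim_modular (V i0) V0
    have h4 := sdim_mono (sup_le (hVX i0) hV0X)
    linarith
  have hV'dim : sdim F X + ∑ i, sdim F (V i) ≤ sdim F V' + n * sdim F X := by
    have := sdim_iInf_ge X V hVX univ
    rwa [Finset.card_univ] at this
  have hVsplit : ∑ i, sdim F (V i) = sdim F (V i0) + ∑ i ∈ univ.erase i0, sdim F (V i) :=
    (Finset.add_sum_erase _ _ (mem_univ i0)).symm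
  have hcardE : ((univ.erase i0).card : ℤ) = n - 1 := by
    rw [Finset.card_erase_of_mem (mem_univ i0), Finset.card_univ]
    omega
  have hDsum : (n - 1) * (sdim F (V i0) - sdim F X) + ∑ i ∈ univ.erase i0, sdim F (V i)
      ≤ ∑ i ∈ univ.erase i0, sdim F (D i) + ∑ i ∈ univ.erase i0, k i := by
    rw [← hcardE, ← nsmul_eq_mul, ← Finset.sum_const, ← Finset.sum_add_distrib,
      ← Finset.sum_add_distrib]
    refine Finset.sum_le_sum fun i _ => ?_
    have := hD i
    linarith
  have hBsum : ∑ i ∈ univ.erase i0, 2 * sdim F (B i) + ∑ i ∈ univ.erase i0, k i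
      ≤ ∑ i ∈ univ.erase i0, 2 * scdim F (B i) (X ⊔ Y i)
        + 2 * ∑ i ∈ univ.erase i0, sdim F (V i) := by
    rw [Finset.mul_sum, ← Finset.sum_add_distrib, ← Finset.sum_add_distrib]
    refine Finset.sum_le_sum fun i _ => ?_
    have h1 := hB i
    have h2 := hk i
    rw [scdim_eq']
    linarith
  have hB0 : (n + 1) * sdim F (B i0) + k i0
      ≤ (n + 1) * scdim F (B i0) (X ⊔ Y i0) + (n + 1) * sdim F (V i0) := by
    have h1 := hB i0
    have h2 := hk i0
    rw [scdim_eq']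
    have h3 := mul_le_mul_of_nonneg_left h1 (by linarith : 0 ≤ n + 1)
    have h4 : 0 ≤ n * k i0 := mul_nonneg (by linarith) h2
    linarith
  rw [scdim_eq' A (X ⊔ Z), scdim_eq A ((⨆ i, Y i) ⊔ Z), ← hW]
  linarith

end Base

section Transfer

variable {F E : Type*} [Field F] [AddCommGroup E] [Module F E] [FiniteDimensional F E]

lemma scdim_nonneg (S T : Submodule F E) : 0 ≤ scdim F S T := by
  have := sdim_mono (le_sup_right : T ≤ S ⊔ T)
  rw [scdim_eq]; linarith

lemma indep_sum_le {ι : Type*} [DecidableEq ι] (R : Submodule F E) (B : ι → Submodule F E)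
    (π : ι → E →ₗ[F] E) (hR : ∀ i, R ≤ LinearMap.ker (π i))
    (hπb : ∀ i, ∀ v ∈ B i, π i v = v) (hπne : ∀ i j, i ≠ j → ∀ v ∈ B j, π i v = 0)
    (s : Finset ι) :
    sdim F R + ∑ i ∈ s, sdim F (B i) ≤ sdim F (R ⊔ ⨆ i ∈ s, B i) := by
  induction s using Finset.induction_on with
  | empty => simp
  | insert j s hj ih =>
    rw [Finset.sum_insert hj, Finset.iSup_insert]
    have h := sdim_step (π j) (R := R ⊔ ⨆ i ∈ s, B i)
      (S := R ⊔ (B j ⊔ ⨆ i ∈ s, B i)) (D := B j)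
      (sup_le_sup_left le_sup_right _)
      (by
        refine sup_le (hR j) (iSup₂_le fun i hi v hv => ?_)
        exact hπne j i (fun h => hj (h ▸ hi)) v hv)
      (fun v hv => ⟨v, Submodule.mem_sup_right (Submodule.mem_sup_left hv), hπb j v hv⟩)
    linarith

lemma sup_diff_left {T T' : Submodule F E} (h : T' ≤ T) (S : Submodule F E) :
    sdim F (T ⊔ S) ≤ sdim F (T' ⊔ S) + (sdim F T - sdim F T') := by
  have h1 := sdim_modular T (T' ⊔ S)
  rw [← sup_assoc, sup_eq_left.2 h] at h1
  have h2 : sdim F T' ≤ sdim F (T ⊓ (T' ⊔ S)) := sdim_mono (le_inf h le_sup_left)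
  linarith

lemma sup_diff {T T' S S' : Submodule F E} (h : T' ≤ T) (h2 : S' ≤ S) :
    sdim F (T ⊔ S) ≤ sdim F (T' ⊔ S') + (sdim F T - sdim F T') + (sdim F S - sdim F S') := by
  have h3 := sup_diff_left h S
  have h4 := sup_diff_left h2 T'
  rw [sup_comm S, sup_comm S'] at h4
  linarith

lemma iSup_diff {ι : Type*} [DecidableEq ι] {T T' : ι → Submodule F E} (h : ∀ i, T' i ≤ T i)
    (s : Finset ι) : sdim F (⨆ i ∈ s, T i) ≤ sdim F (⨆ i ∈ s, T' i)
      + ∑ i ∈ s, (sdim F (T i) - sdim F (T' i)) := by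
  induction s using Finset.induction_on with
  | empty => simp
  | insert j s hj ih =>
    rw [Finset.sum_insert hj, Finset.iSup_insert, Finset.iSup_insert]
    have := sup_diff (h j) (iSup₂_mono fun i (_ : i ∈ s) => h i)
    linarith

lemma scdim_transfer {S S' T T' : Submodule F E} (h : S' ≤ S) (h2 : T' ≤ T) :
    scdim F S' T' ≤ scdim F S T + (sdim F T - sdim F T') := by
  have := sdim_mono (sup_le_sup h h2)
  rw [scdim_eq, scdim_eq]
  linarith

lemma trim_bound (Y : Submodule F E) {S S' : Submodule F E} (h : S' ≤ S) :
    sdim F Y - sdim F (Y ⊓ S') ≤ scdim F Y S + (sdim F S - sdim F S') := by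
  have := scdim_transfer (le_refl Y) h
  rwa [scdim_eq' Y S'] at this

lemma general_case {ι : Type*} [Fintype ι] [DecidableEq ι] (i0 : ι)
    (hcard : (Fintype.card ι : F) = 0)
    (A X Z : Submodule F E) (B Y : ι → Submodule F E) :
    2 * sdim F A + ((Fintype.card ι : ℤ) + 1) * sdim F (B i0)
        + ∑ i ∈ univ.erase i0, 2 * sdim F (B i)
      ≤ (2 * (Fintype.card ι : ℤ) - 1) * sdim F X + ∑ i, sdim F (Y i) + sdim F Z
        + (3 * (Fintype.card ι : ℤ)) * scdim F X (A ⊔ ⨆ i, B i)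
        + ((Fintype.card ι : ℤ) + 2) * scdim F (Y i0) (A ⊔ ⨆ j ∈ univ.erase i0, B j)
        + ∑ i ∈ univ.erase i0, 3 * scdim F (Y i) (A ⊔ ⨆ j ∈ univ.erase i, B j)
        + 2 * scdim F Z (⨆ i, B i)
        + scdim F A ((⨆ i, Y i) ⊔ Z)
        + scdim F A (X ⊔ Z)
        + ((Fintype.card ι : ℤ) + 1) * scdim F (B i0) (X ⊔ Y i0)
        + ∑ i ∈ univ.erase i0, 2 * scdim F (B i) (X ⊔ Y i)
        + (3 * (Fintype.card ι : ℤ) + 1)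
            * (sdim F A + (∑ i, sdim F (B i)) - sdim F (A ⊔ ⨆ i, B i)) := by
  let S : Option ι → Submodule F E := fun o => o.elim A B
  obtain ⟨T, hTS, hsup, hind⟩ := exists_indep _ S rfl
  obtain ⟨pr, hprm, hprs, hprne, hprsum⟩ := exists_proj T hind
  let A' := T none
  let B' : ι → Submodule F E := fun i => T (some i)
  have hA' : A' ≤ A := hTS none
  have hB' : ∀ i, B' i ≤ B i := fun i => hTS (some i)
  have hS1 : iSup S = A ⊔ ⨆ i, B i := iSup_option S
  have hT1 : iSup T = A' ⊔ ⨆ i, B' i := iSup_option T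
  have hV : A ⊔ ⨆ i, B i = A' ⊔ ⨆ i, B' i := by rw [← hS1, ← hT1, hsup]
  let X' := X ⊓ (A ⊔ ⨆ i, B i)
  let Y' : ι → Submodule F E := fun i => Y i ⊓ (A' ⊔ ⨆ j ∈ univ.erase i, B' j)
  let Z' := Z ⊓ ⨆ i, B' i
  have hπne : ∀ i j : ι, i ≠ j → ∀ v ∈ B' j, pr (some i) v = 0 := fun i j hij v hv =>
    hprne (some i) (some j) (by simpa using hij) v hv
  have hπa : ∀ i : ι, ∀ v ∈ A', pr (some i) v = 0 := fun i v hv =>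
    hprne (some i) none (by simp) v hv
  have hPb : ∀ i : ι, ∀ v ∈ B' i, pr none v = 0 := fun i v hv =>
    hprne none (some i) (by simp) v hv
  have base := base_case i0 hcard A' X' Z' B' Y' (pr none) (fun i => pr (some i))
    (hprm none) (hprs none) hPb (fun i => hprm (some i)) hπa (fun i => hprs (some i)) hπne
    (by
      intro v hv
      have h1 : v ∈ iSup T := by rw [hsup, hS1]; exact hv.2
      have h2 := hprsum v h1
      rwa [Fintype.sum_option] at h2)
    (by
      intro i v hv
      have h : A' ⊔ ⨆ j ∈ univ.erase i, B' j ≤ LinearMap.ker (pr (some i)) :=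
        sup_le (hπa i) (iSup₂_le fun j hj => hπne i j (Finset.mem_erase.1 hj).1.symm)
      exact h hv.2)
    (by
      intro v hv
      have h : ⨆ j, B' j ≤ LinearMap.ker (pr none) := iSup_le hPb
      exact h hv.2)
  set n : ℤ := (Fintype.card ι : ℤ) with hn
  have hn1 : 1 ≤ n := by
    have : 0 < Fintype.card ι := Fintype.card_pos_iff.2 ⟨i0⟩
    omega
  have hcardE : ((univ.erase i0).card : ℤ) = n - 1 := by
    rw [Finset.card_erase_of_mem (mem_univ i0), Finset.card_univ]
    omega
  have iSup_univ : ∀ C : ι → Submodule F E, ⨆ i, C i = ⨆ i ∈ (univ : Finset ι), C i := by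
    intro C; simp
  have hX' : X' ≤ X := inf_le_left
  have hY' : ∀ i, Y' i ≤ Y i := fun i => inf_le_left
  have hZ' : Z' ≤ Z := inf_le_left
  -- losses
  obtain ⟨d0, hd0⟩ : ∃ d0, d0 = sdim F A - sdim F A' := ⟨_, rfl⟩
  obtain ⟨d, hd⟩ : ∃ d : ι → ℤ, ∀ i, d i = sdim F (B i) - sdim F (B' i) := ⟨_, fun _ => rfl⟩
  obtain ⟨tX, htX⟩ : ∃ t, t = sdim F X - sdim F X' := ⟨_, rfl⟩
  obtain ⟨tZ, htZ⟩ : ∃ t, t = sdim F Z - sdim F Z' := ⟨_, rfl⟩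
  obtain ⟨tY, htY⟩ : ∃ t : ι → ℤ, ∀ i, t i = sdim F (Y i) - sdim F (Y' i) := ⟨_, fun _ => rfl⟩
  have hd0n : 0 ≤ d0 := by have := sdim_mono hA'; linarith
  have hdn : ∀ i, 0 ≤ d i := fun i => by have := sdim_mono (hB' i); have := hd i; linarith
  obtain ⟨D, hD⟩ : ∃ D, D = d0 + ∑ i, d i := ⟨_, rfl⟩
  have hdsum : ∑ i, d i = ∑ i, sdim F (B i) - ∑ i, sdim F (B' i) := by
    rw [← Finset.sum_sub_distrib]
    exact Finset.sum_congr rfl fun i _ => hd i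
  have hDI : D ≤ sdim F A + (∑ i, sdim F (B i)) - sdim F (A ⊔ ⨆ i, B i) := by
    have h1 := sdim_sup_le A' (⨆ i, B' i)
    have h2 := sdim_iSup_le B' univ
    rw [← iSup_univ] at h2
    rw [hV]
    linarith
  have hd0D : d0 ≤ D := by
    have : 0 ≤ ∑ i, d i := Finset.sum_nonneg fun i _ => hdn i
    linarith
  have bX : tX ≤ scdim F X (A ⊔ ⨆ i, B i) := by
    rw [scdim_eq']
    exact htX.le
  have bZ : tZ ≤ scdim F Z (⨆ i, B i) + (D - d0) := by
    have h1 := trim_bound Z (iSup_mono hB')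
    have h2 := sdim_iSup_le B univ
    have h3 := indep_sum_le ⊥ B' (fun i => pr (some i)) (fun i => bot_le)
      (fun i => hprs (some i)) hπne univ
    rw [← iSup_univ] at h2 h3
    rw [bot_sup_eq] at h3
    have h4 := sdim_nonneg (⊥ : Submodule F E)
    have h5 : tZ = sdim F Z - sdim F (Z ⊓ ⨆ i, B' i) := htZ
    linarith
  have bY : ∀ i, tY i ≤ scdim F (Y i) (A ⊔ ⨆ j ∈ univ.erase i, B j) + (D - d i) := by
    intro i
    have h1 := trim_bound (Y i) (sup_le_sup hA'
      (iSup₂_mono fun j (_ : j ∈ univ.erase i) => hB' j))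
    have h2 := sdim_iSup_le B (univ.erase i)
    have h2' := sdim_sup_le A (⨆ j ∈ univ.erase i, B j)
    have h3 := indep_sum_le A' B' (fun i => pr (some i)) (fun i => hπa i)
      (fun i => hprs (some i)) hπne (univ.erase i)
    have h5 : tY i = sdim F (Y i) - sdim F (Y i ⊓ (A' ⊔ ⨆ j ∈ univ.erase i, B' j)) := htY i
    have h6 := Finset.add_sum_erase univ (fun i => sdim F (B i)) (mem_univ i)
    have h7 := Finset.add_sum_erase univ (fun i => sdim F (B' i)) (mem_univ i)
    have h8 := hd i
    linarith
  have htYsum : ∑ i, tY i = ∑ i, sdim F (Y i) - ∑ i, sdim F (Y' i) := by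
    rw [← Finset.sum_sub_distrib]
    exact Finset.sum_congr rfl fun i _ => htY i
  -- transfers
  have cA1 : scdim F A' ((⨆ i, Y' i) ⊔ Z') ≤ scdim F A ((⨆ i, Y i) ⊔ Z) + ∑ i, tY i + tZ := by
    have h1 := scdim_transfer hA' (sup_le_sup (iSup_mono hY') hZ')
    have h2 := sup_diff (iSup_mono hY') hZ'
    have h3 := iSup_diff hY' univ
    rw [← iSup_univ, ← iSup_univ, Finset.sum_sub_distrib] at h3
    linarith
  have cA2 : scdim F A' (X' ⊔ Z') ≤ scdim F A (X ⊔ Z) + tX + tZ := by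
    have h1 := scdim_transfer hA' (sup_le_sup hX' hZ')
    have h2 := sup_diff hX' hZ'
    linarith
  have cB : ∀ i, scdim F (B' i) (X' ⊔ Y' i) ≤ scdim F (B i) (X ⊔ Y i) + tX + tY i := by
    intro i
    have h1 := scdim_transfer (hB' i) (sup_le_sup hX' (hY' i))
    have h2 := sup_diff hX' (hY' i)
    have := htY i
    linarith
  -- summing up
  have s1 : ∑ i ∈ univ.erase i0, 2 * sdim F (B i)
      + ∑ i ∈ univ.erase i0, 2 * scdim F (B' i) (X' ⊔ Y' i)
      ≤ ∑ i ∈ univ.erase i0, 2 * sdim F (B' i)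
      + ∑ i ∈ univ.erase i0, 2 * scdim F (B i) (X ⊔ Y i)
      + ∑ i ∈ univ.erase i0, 3 * scdim F (Y i) (A ⊔ ⨆ j ∈ univ.erase i, B j)
      + (n - 1) * (2 * tX + 2 * D) := by
    rw [← hcardE, ← nsmul_eq_mul, ← Finset.sum_const, ← Finset.sum_add_distrib,
      ← Finset.sum_add_distrib, ← Finset.sum_add_distrib, ← Finset.sum_add_distrib]
    refine Finset.sum_le_sum fun i _ => ?_
    have h1 := cB i
    have h2 := bY i
    have h3 := hd i
    have h4 := scdim_nonneg (Y i) (A ⊔ ⨆ j ∈ univ.erase i, B j)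
    linarith
  have s2 : (n + 1) * (sdim F (B i0) + scdim F (B' i0) (X' ⊔ Y' i0))
      ≤ (n + 1) * (sdim F (B' i0) + scdim F (B i0) (X ⊔ Y i0)
        + scdim F (Y i0) (A ⊔ ⨆ j ∈ univ.erase i0, B j) + tX + D) := by
    refine mul_le_mul_of_nonneg_left ?_ (by linarith)
    have h1 := cB i0
    have h2 := bY i0
    have h3 := hd i0
    linarith
  have s3 : (n + 1) * tX ≤ (3 * n) * scdim F X (A ⊔ ⨆ i, B i) := by
    have h1 := scdim_nonneg X (A ⊔ ⨆ i, B i)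
    have h2 := mul_le_mul_of_nonneg_left bX (by linarith : 0 ≤ n + 1)
    have h3 := mul_nonneg (by linarith : 0 ≤ 2 * n - 1) h1
    linarith
  have s4 := mul_le_mul_of_nonneg_left hDI (by linarith : 0 ≤ 3 * n + 1)
  have s5 := scdim_nonneg (Y i0) (A ⊔ ⨆ j ∈ univ.erase i0, B j)
  have s6 := scdim_nonneg Z (⨆ i, B i)
  have s7 : sdim F X' = sdim F X - tX := by linarith
  rw [s7] at base
  linarith

end Transfer

/-- For `q` the product of the distinct primes `p 1, …, p l` and `F` a finite
field whose characteristic is among them, the characteristic-dependent linear rank inequality of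
Theorem 2 of the paper holds for all subspaces `A, B 1, …, B q, X, Z, Y 1, …, Y q` of a
finite-dimensional `F`-vector space `E`.  Here `B (idx1 hp hq)` plays the role of `B 1` and
`Y (idx1 hp hq)` that of `Y 1`. -/
theorem rank_inequality_char_in_set
    (l : ℕ) (p : Fin l → ℕ) (hp : ∀ i, (p i).Prime) (hpinj : Function.Injective p)
    (q : ℕ) (hq : q = ∏ i, p i)
    (F : Type*) [Field F] [Fintype F] (hchar : ∃ i, ringChar F = p i)
    (E : Type*) [AddCommGroup E] [Module F E] [FiniteDimensional F E]
    (A X Z : Submodule F E)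
    (B Y : Fin q → Submodule F E) :
    2 * sdim F A + ((q : ℤ) + 1) * sdim F (B (idx1 hp hq))
        + ∑ i ∈ univ.erase (idx1 hp hq), 2 * sdim F (B i)
      ≤ (2 * (q : ℤ) - 1) * sdim F X + ∑ i : Fin q, sdim F (Y i) + sdim F Z
        + (3 * (q : ℤ)) * scdim F X (A ⊔ ⨆ i, B i)
        + ((q : ℤ) + 2) * scdim F (Y (idx1 hp hq))
            (A ⊔ ⨆ j ∈ univ.erase (idx1 hp hq), B j)
        + ∑ i ∈ univ.erase (idx1 hp hq), 3 * scdim F (Y i) (A ⊔ ⨆ j ∈ univ.erase i, B j)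
        + 2 * scdim F Z (⨆ i, B i)
        + scdim F A ((⨆ i, Y i) ⊔ Z)
        + scdim F A (X ⊔ Z)
        + ((q : ℤ) + 1) * scdim F (B (idx1 hp hq)) (X ⊔ Y (idx1 hp hq))
        + ∑ i ∈ univ.erase (idx1 hp hq), 2 * scdim F (B i) (X ⊔ Y i)
        + (3 * (q : ℤ) + 1)
            * (sdim F A + (∑ i : Fin q, sdim F (B i)) - sdim F (A ⊔ ⨆ i, B i)) := by
  have hcard : (Fintype.card (Fin q) : F) = 0 := by
    obtain ⟨i, hi⟩ := hchar
    rw [Fintype.card_fin, ringChar.spec, hi, hq]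
    exact Finset.dvd_prod_of_mem p (mem_univ i)
  have h := general_case (F := F) (idx1 hp hq) hcard A X Z B Y
  simpa only [Fintype.card_fin] using h
end

section
/- Let p_1, …, p_l be distinct primes, q = p_1·p_2···p_l, and let p be a prime not among p_1, …, p_l. Let F be a field of characteristic p (so the image of q in F is nonzero), let E = F^{q+1} with standard basis e_1, …, e_{q+1}, and define the one-dimensional subspaces A = span(e_1), B_i = span(e_{i+1}) for 1 ≤ i ≤ q, X = span(e_1 + e_2 + ⋯ + e_{q+1}), Y_i = span(Σ_{j ≠ i+1} e_j) for 1 ≤ i ≤ q, and Z = span(e_2 + ⋯ + e_{q+1}). Then every conditional term in the inequality below vanishes, the left-hand side equals 3q+1, the right-hand side equals 3q, and hence the inequality FAILS for these subspaces: 2H(A) + (q+1)H(B_1) + Σ_{i=2}^{q} 2H(B_i) ≤ (2q−1)H(X) + Σ_{i=1}^{q} H(Y_i) + H(Z) + 3q·H(X | A, B_1, …, B_q) + (q+2)H(Y_1 | A, B_2, …, B_q) + Σ_{i=2}^{q} 3H(Y_i | A, B_1, …, B_{i−1}, B_{i+1}, …, B_q) + 2H(Z | B_1, …, B_q) + H(A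 | Y_1, …, Y_q, Z) + H(A | X, Z) + (q+1)H(B_1 | X, Y_1) + Σ_{i=2}^{q} 2H(B_i | X, Y_i) + (3q+1)(H(A) + Σ_{i=1}^{q} H(B_i) − H(A, B_1, …, B_q)). -/
open Finset

theorem scdim_zero_of_le {F E : Type*} [Field F] [AddCommGroup E] [Module F E]
    {S T : Submodule F E} (h : S ≤ T) : scdim F S T = 0 := by
  unfold scdim
  rw [sup_eq_right.mpr h, sub_self]

theorem sdim_span_one {F E : Type*} [Field F] [AddCommGroup E] [Module F E]
    {v : E} (h : v ≠ 0) : sdim F (F ∙ v) = 1 := by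
  unfold sdim
  rw [finrank_span_singleton h]; rfl

/-- Let `q` be the product of the distinct primes `p 1, …, p l`, and let `F`
be a field whose characteristic is a prime `pp` not among these primes.  In `E = F^(q+1)`
(with coordinates indexed by `Fin (q+1)`, so that the `1`-based basis vector `e k` is the
indicator of the `0`-based index `k - 1`), take the one-dimensional subspaces
`A = span (e 1)`, `B i = span (e (i+1))` (`1 ≤ i ≤ q`), `X = span (e 1 + ⋯ + e (q+1))`,
`Y i = span (∑_{j ≠ i+1} e j)`, `Z = span (e 2 + ⋯ + e (q+1))`.
Then all conditional terms of the inequality of Theorem 2 vanish, its left-hand side equals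
`3q + 1`, its right-hand side equals `3q`, and the inequality fails.
(`B (idx1 hp hq)` plays the role of `B 1` and `Y (idx1 hp hq)` that of `Y 1`.) -/
theorem rank_inequality_may_not_hold_char_not_in_set
    (l : ℕ) (p : Fin l → ℕ) (hp : ∀ i, (p i).Prime) (hpinj : Function.Injective p)
    (q : ℕ) (hq : q = ∏ i, p i)
    (pp : ℕ) (hpp : pp.Prime) (hnotmem : ∀ i, pp ≠ p i)
    (F : Type*) [Field F] [CharP F pp]
    (A X Z : Submodule F (Fin (q + 1) → F))
    (B Y : Fin q → Submodule F (Fin (q + 1) → F))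
    (hA : A = F ∙ (fun j : Fin (q + 1) => if (j : ℕ) = 0 then (1 : F) else 0))
    (hB : ∀ i, B i = F ∙ (fun j : Fin (q + 1) => if (j : ℕ) = (i : ℕ) + 1 then (1 : F) else 0))
    (hX : X = F ∙ (fun _ : Fin (q + 1) => (1 : F)))
    (hY : ∀ i, Y i = F ∙ (fun j : Fin (q + 1) => if (j : ℕ) = (i : ℕ) + 1 then (0 : F) else 1))
    (hZ : Z = F ∙ (fun j : Fin (q + 1) => if 1 ≤ (j : ℕ) then (1 : F) else 0)) :
    scdim F X (A ⊔ ⨆ i, B i) = 0 ∧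
    (∀ i, scdim F (Y i) (A ⊔ ⨆ j ∈ univ.erase i, B j) = 0) ∧
    scdim F Z (⨆ i, B i) = 0 ∧
    scdim F A ((⨆ i, Y i) ⊔ Z) = 0 ∧
    scdim F A (X ⊔ Z) = 0 ∧
    (∀ i, scdim F (B i) (X ⊔ Y i) = 0) ∧
    (2 * sdim F A + ((q : ℤ) + 1) * sdim F (B (idx1 hp hq))
        + ∑ i ∈ univ.erase (idx1 hp hq), 2 * sdim F (B i)
      = 3 * (q : ℤ) + 1) ∧
    ((2 * (q : ℤ) - 1) * sdim F X + ∑ i : Fin q, sdim F (Y i) + sdim F Z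
        + (3 * (q : ℤ)) * scdim F X (A ⊔ ⨆ i, B i)
        + ((q : ℤ) + 2) * scdim F (Y (idx1 hp hq))
            (A ⊔ ⨆ j ∈ univ.erase (idx1 hp hq), B j)
        + ∑ i ∈ univ.erase (idx1 hp hq), 3 * scdim F (Y i) (A ⊔ ⨆ j ∈ univ.erase i, B j)
        + 2 * scdim F Z (⨆ i, B i)
        + scdim F A ((⨆ i, Y i) ⊔ Z)
        + scdim F A (X ⊔ Z)
        + ((q : ℤ) + 1) * scdim F (B (idx1 hp hq)) (X ⊔ Y (idx1 hp hq))
        + ∑ i ∈ univ.erase (idx1 hp hq), 2 * scdim F (B i) (X ⊔ Y i)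
        + (3 * (q : ℤ) + 1)
            * (sdim F A + (∑ i : Fin q, sdim F (B i)) - sdim F (A ⊔ ⨆ i, B i))
      = 3 * (q : ℤ)) ∧
    ¬ (2 * sdim F A + ((q : ℤ) + 1) * sdim F (B (idx1 hp hq))
        + ∑ i ∈ univ.erase (idx1 hp hq), 2 * sdim F (B i)
      ≤ (2 * (q : ℤ) - 1) * sdim F X + ∑ i : Fin q, sdim F (Y i) + sdim F Z
        + (3 * (q : ℤ)) * scdim F X (A ⊔ ⨆ i, B i)
        + ((q : ℤ) + 2) * scdim F (Y (idx1 hp hq))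
            (A ⊔ ⨆ j ∈ univ.erase (idx1 hp hq), B j)
        + ∑ i ∈ univ.erase (idx1 hp hq), 3 * scdim F (Y i) (A ⊔ ⨆ j ∈ univ.erase i, B j)
        + 2 * scdim F Z (⨆ i, B i)
        + scdim F A ((⨆ i, Y i) ⊔ Z)
        + scdim F A (X ⊔ Z)
        + ((q : ℤ) + 1) * scdim F (B (idx1 hp hq)) (X ⊔ Y (idx1 hp hq))
        + ∑ i ∈ univ.erase (idx1 hp hq), 2 * scdim F (B i) (X ⊔ Y i)
        + (3 * (q : ℤ) + 1)
            * (sdim F A + (∑ i : Fin q, sdim F (B i)) - sdim F (A ⊔ ⨆ i, B i))) := by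
  have hqpos : 0 < q := (idx1 hp hq).pos
  have hqF : (q : F) ≠ 0 := by
    intro h
    rw [CharP.cast_eq_zero_iff F pp, hq, Prime.dvd_finsetProd_iff hpp.prime] at h
    obtain ⟨i, -, hi⟩ := h
    exact hnotmem i ((Nat.prime_dvd_prime_iff_eq hpp (hp i)).mp hi)
  obtain ⟨a, ha⟩ : ∃ a : Fin (q + 1) → F, a = (fun j : Fin (q + 1) => if (j : ℕ) = 0 then (1 : F) else 0) :=
    ⟨_, rfl⟩
  obtain ⟨b, hb⟩ : ∃ b : Fin q → Fin (q + 1) → F,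
      b = (fun (i : Fin q) (j : Fin (q + 1)) => if (j : ℕ) = (i : ℕ) + 1 then (1 : F) else 0) := ⟨_, rfl⟩
  obtain ⟨x, hx⟩ : ∃ x : Fin (q + 1) → F, x = (fun _ => (1 : F)) := ⟨_, rfl⟩
  obtain ⟨y, hy⟩ : ∃ y : Fin q → Fin (q + 1) → F,
      y = (fun (i : Fin q) (j : Fin (q + 1)) => if (j : ℕ) = (i : ℕ) + 1 then (0 : F) else 1) := ⟨_, rfl⟩
  obtain ⟨z, hz⟩ : ∃ z : Fin (q + 1) → F, z = (fun j : Fin (q + 1) => if 1 ≤ (j : ℕ) then (1 : F) else 0) :=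
    ⟨_, rfl⟩
  have hA' : A = F ∙ a := by rw [hA, ha]
  have hB' : ∀ i, B i = F ∙ b i := by intro i; rw [hB, hb]
  have hX' : X = F ∙ x := by rw [hX, hx]
  have hY' : ∀ i, Y i = F ∙ y i := by intro i; rw [hY, hy]
  have hZ' : Z = F ∙ z := by rw [hZ, hz]
  have ezb : z = ∑ i, b i := by
    funext j
    rw [Finset.sum_apply]
    refine Fin.cases ?_ (fun k => ?_) j
    · simp [hz, hb]
    · simp [hz, hb, Fin.val_inj]
  have exz : x = a + z := by
    funext j
    refine Fin.cases ?_ (fun k => ?_) j <;> simp [hx, ha, hz]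
  have exy : ∀ i, x = b i + y i := by
    intro i
    funext j
    by_cases h : (j : ℕ) = i + 1 <;> simp [hx, hb, hy, h]
  have na : a ≠ 0 := by
    intro h
    have := congrFun h 0
    simp [ha] at this
  have nb : ∀ i, b i ≠ 0 := by
    intro i h
    have := congrFun h i.succ
    simp [hb] at this
  have nx : x ≠ 0 := by
    intro h
    have := congrFun h 0
    simp [hx] at this
  have ny : ∀ i, y i ≠ 0 := by
    intro i h
    have := congrFun h 0
    simp [hy] at this
  have nz : z ≠ 0 := by
    intro h
    have := congrFun h (idx1 hp hq).succ
    simp [hz] at this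
  have dA : sdim F A = 1 := by rw [hA']; exact sdim_span_one na
  have dB : ∀ i, sdim F (B i) = 1 := by intro i; rw [hB']; exact sdim_span_one (nb i)
  have dX : sdim F X = 1 := by rw [hX']; exact sdim_span_one nx
  have dY : ∀ i, sdim F (Y i) = 1 := by intro i; rw [hY']; exact sdim_span_one (ny i)
  have dZ : sdim F Z = 1 := by rw [hZ']; exact sdim_span_one nz
  have maA : a ∈ A := by rw [hA']; exact Submodule.mem_span_singleton_self a
  have mbB : ∀ i, b i ∈ B i := by intro i; rw [hB']; exact Submodule.mem_span_singleton_self _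
  have mxX : x ∈ X := by rw [hX']; exact Submodule.mem_span_singleton_self _
  have myY : ∀ i, y i ∈ Y i := by intro i; rw [hY']; exact Submodule.mem_span_singleton_self _
  have mzZ : z ∈ Z := by rw [hZ']; exact Submodule.mem_span_singleton_self _
  have mzB : z ∈ ⨆ i, B i := by
    rw [ezb]
    exact Submodule.sum_mem _ fun i _ => Submodule.mem_iSup_of_mem i (mbB i)
  have htop : A ⊔ ⨆ i, B i = ⊤ := by
    rw [eq_top_iff]
    intro v _
    have hv : v = v 0 • a + ∑ i : Fin q, v i.succ • b i := by
      funext j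
      rw [Pi.add_apply, Finset.sum_apply]
      refine Fin.cases ?_ (fun k => ?_) j
      · simp [ha, hb]
      · simp [ha, hb, Fin.val_inj]
    rw [hv]
    refine Submodule.add_mem _ (Submodule.mem_sup_left (A.smul_mem _ maA))
      (Submodule.mem_sup_right ?_)
    exact Submodule.sum_mem _ fun i _ =>
      Submodule.mem_iSup_of_mem i ((B i).smul_mem _ (mbB i))
  have dtop : sdim F (A ⊔ ⨆ i, B i) = (q : ℤ) + 1 := by
    rw [htop]
    unfold sdim
    rw [finrank_top, Module.finrank_fin_fun]
    push_cast
    rfl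
  have c1 : scdim F X (A ⊔ ⨆ i, B i) = 0 := scdim_zero_of_le (by rw [htop]; exact le_top)
  have c2 : ∀ i, scdim F (Y i) (A ⊔ ⨆ j ∈ univ.erase i, B j) = 0 := by
    intro i
    apply scdim_zero_of_le
    rw [hY' i, Submodule.span_singleton_le_iff_mem]
    have e : y i = a + ∑ j ∈ univ.erase i, b j := by
      have h1 := Finset.add_sum_erase univ b (mem_univ i)
      have h2 := exy i
      rw [exz, ezb, ← h1] at h2
      have h3 : b i + y i = b i + (a + ∑ j ∈ univ.erase i, b j) := by
        rw [← h2]; abel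
      exact add_left_cancel h3
    rw [e]
    refine Submodule.add_mem _ (Submodule.mem_sup_left maA) (Submodule.mem_sup_right ?_)
    exact Submodule.sum_mem _ fun j hj =>
      Submodule.mem_iSup_of_mem j (Submodule.mem_iSup_of_mem hj (mbB j))
  have c3 : scdim F Z (⨆ i, B i) = 0 := by
    apply scdim_zero_of_le
    rw [hZ', Submodule.span_singleton_le_iff_mem]
    exact mzB
  have c4 : scdim F A ((⨆ i, Y i) ⊔ Z) = 0 := by
    apply scdim_zero_of_le
    rw [hA', Submodule.span_singleton_le_iff_mem]
    have e : (q : F) • a = ∑ i, y i - ((q : F) - 1) • z := by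
      have h1 : ∑ i : Fin q, x = ∑ i, (b i + y i) := Finset.sum_congr rfl fun i _ => exy i
      rw [Finset.sum_add_distrib, ← ezb, Finset.sum_const, Finset.card_univ, Fintype.card_fin,
        ← Nat.cast_smul_eq_nsmul F, exz, smul_add] at h1
      rw [sub_smul, one_smul]
      have h2 : ∑ i, y i = (q : F) • a + (q : F) • z - z := by rw [h1]; abel
      rw [h2]; abel
    have e2 : a = (q : F)⁻¹ • (∑ i, y i - ((q : F) - 1) • z) := by
      rw [← e, inv_smul_smul₀ hqF]
    rw [e2]
    refine Submodule.smul_mem _ _ (Submodule.sub_mem _ (Submodule.mem_sup_left ?_)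
      (Submodule.mem_sup_right (Z.smul_mem _ mzZ)))
    exact Submodule.sum_mem _ fun i _ => Submodule.mem_iSup_of_mem i (myY i)
  have c5 : scdim F A (X ⊔ Z) = 0 := by
    apply scdim_zero_of_le
    rw [hA', Submodule.span_singleton_le_iff_mem]
    rw [eq_sub_of_add_eq exz.symm]
    exact Submodule.sub_mem _ (Submodule.mem_sup_left mxX) (Submodule.mem_sup_right mzZ)
  have c6 : ∀ i, scdim F (B i) (X ⊔ Y i) = 0 := by
    intro i
    apply scdim_zero_of_le
    rw [hB' i, Submodule.span_singleton_le_iff_mem]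
    rw [eq_sub_of_add_eq (exy i).symm]
    exact Submodule.sub_mem _ (Submodule.mem_sup_left mxX) (Submodule.mem_sup_right (myY i))
  have hcard : (((univ.erase (idx1 hp hq)).card : ℕ) : ℤ) = (q : ℤ) - 1 := by
    rw [Finset.card_erase_of_mem (mem_univ _), Finset.card_univ, Fintype.card_fin]
    omega
  rw [c1, c3, c4, c5, dA, dX, dZ, dtop]
  simp only [c2, c6, dB, dY, Finset.sum_const, nsmul_eq_mul, hcard, Finset.card_univ,
    Fintype.card_fin]
  refine ⟨trivial, fun _ => trivial, trivial, trivial, trivial, fun _ => trivial, ?_, ?_, ?_⟩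
  · ring
  · ring
  · intro h
    linarith
end
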